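/- Let 1 < p ≤ 2 and p < q. For every constant K > 0 there exist positive integers n, m and a nonzero positive semidefinite matrix Y ∈ M_n ⊗ M_m such that Ψ_{p,q}(Y) > K · ‖Y‖_{NC:p,q}. In particular there is a sequence of positive semidefinite matrices Y^{(k)} ∈ M_{n_k} ⊗ M_{m_k} with Ψ_{p,q}(Y^{(k)}) / ‖Y^{(k)}‖_{NC:p,q} → ∞ as k → ∞. -/

import Mathlib

open scoped Kronecker
open Matrix
open scoped ENNReal NNReal ComplexOrder

noncomputable section

open scoped Classical in
/-- The Schatten `p`-norm of a complex square matrix, `p ∈ [1,∞]` (as an `ℝ≥0∞`).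
For finite `p` it equals `(Tr |A|^p)^{1/p}`, computed via the eigenvalues of `Aᴴ * A`;
for `p = ∞` it is the operator norm (largest singular value). -/
noncomputable def schattenNorm {k : Type*} [Fintype k] [DecidableEq k] (p : ℝ≥0∞)
    (A : Matrix k k ℂ) : ℝ :=
  if p = ⊤ then
    ⨆ i, Real.sqrt ((Matrix.posSemidef_conjTranspose_mul_self A).isHermitian.eigenvalues i)
  else
    (∑ i, (Matrix.posSemidef_conjTranspose_mul_self A).isHermitian.eigenvalues i
        ^ (p.toReal / 2)) ^ (1 / p.toReal)

/-- `r` defined by `1/r = max{1/p, 1/q} - min{1/p, 1/q}` (so `r = ∞` when `p = q`). -/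
noncomputable def ncR (p q : ℝ≥0∞) : ℝ≥0∞ := (max p⁻¹ q⁻¹ - min p⁻¹ q⁻¹)⁻¹

/-- The non-commutative `L^q(L^p)` norm (supremum form, used when `p ≤ q`):
`sup_{A,B} ‖(A ⊗ I) Y (B ⊗ I)‖_p / (‖A‖_{2r} ‖B‖_{2r})`. -/
noncomputable def ncNormSup {k l : Type*} [Fintype k] [DecidableEq k] [Fintype l] [DecidableEq l]
    (p q : ℝ≥0∞) (Y : Matrix (k × l) (k × l) ℂ) : ℝ :=
  ⨆ A : Matrix k k ℂ, ⨆ B : Matrix k k ℂ,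
    schattenNorm p ((A ⊗ₖ (1 : Matrix l l ℂ)) * Y * (B ⊗ₖ (1 : Matrix l l ℂ))) /
      (schattenNorm (2 * ncR p q) A * schattenNorm (2 * ncR p q) B)

/-- The non-commutative `L^q(L^p)` norm (infimum form, used when `q ≤ p`):
`inf { ∑ᵢ ‖Aᵢ‖_{2r} ‖Bᵢ‖_{2r} ‖Zᵢ‖_p : Y = ∑ᵢ (Aᵢ ⊗ I) Zᵢ (Bᵢ ⊗ I) }`. -/
noncomputable def ncNormInf {k l : Type*} [Fintype k] [DecidableEq k] [Fintype l] [DecidableEq l]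
    (p q : ℝ≥0∞) (Y : Matrix (k × l) (k × l) ℂ) : ℝ :=
  sInf { s : ℝ | ∃ (N : ℕ) (A B : Fin N → Matrix k k ℂ)
      (Z : Fin N → Matrix (k × l) (k × l) ℂ),
    Y = ∑ i, (A i ⊗ₖ (1 : Matrix l l ℂ)) * Z i * (B i ⊗ₖ (1 : Matrix l l ℂ)) ∧
    s = ∑ i, schattenNorm (2 * ncR p q) (A i) * schattenNorm (2 * ncR p q) (B i) *
          schattenNorm p (Z i) }

open scoped Classical in
/-- The non-commutative `L^q(L^p)` norm `‖·‖_{NC:p,q}`. -/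
noncomputable def ncNorm {k l : Type*} [Fintype k] [DecidableEq k] [Fintype l] [DecidableEq l]
    (p q : ℝ≥0∞) (Y : Matrix (k × l) (k × l) ℂ) : ℝ :=
  if p ≤ q then ncNormSup p q Y else ncNormInf p q Y

open scoped Classical in
/-- Real power of a Hermitian matrix via the spectral decomposition (junk value `0` on
non-Hermitian matrices). -/
noncomputable def mrpow {k : Type*} [Fintype k] [DecidableEq k] (A : Matrix k k ℂ) (e : ℝ) :
    Matrix k k ℂ :=
  if hA : A.IsHermitian then
    (hA.eigenvectorUnitary : Matrix k k ℂ) *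
      Matrix.diagonal (fun i => ((hA.eigenvalues i ^ e : ℝ) : ℂ)) *
      ((hA.eigenvectorUnitary : Matrix k k ℂ))ᴴ
  else 0

/-- Partial trace over the second (inside) factor. -/
noncomputable def ptrace2 {k l : Type*} [Fintype l]
    (Y : Matrix (k × l) (k × l) ℂ) : Matrix k k ℂ :=
  fun i i' => ∑ j : l, Y (i, j) (i', j)

/-- The Carlen–Lieb quantity `Ψ_{p,q}(Y) = (Tr₁ (Tr₂ Y^p)^{q/p})^{1/q}`. -/
noncomputable def Psi {k l : Type*} [Fintype k] [DecidableEq k] [Fintype l] [DecidableEq l]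
    (p q : ℝ) (Y : Matrix (k × l) (k × l) ℂ) : ℝ :=
  (Matrix.trace (mrpow (ptrace2 (mrpow Y p)) (q / p))).re ^ (1 / q)

/-- The quantity `|||X|||_{p,q} = inf {Ψ_{p,q}(A) + Ψ_{p,q}(B) : X + A = B, A ≥ 0, B ≥ 0}`,
for `X` on the space `M_k ⊗ (M_l ⊗ M_2)`. -/
noncomputable def tripleNorm {k l : Type*} [Fintype k] [DecidableEq k] [Fintype l] [DecidableEq l]
    (p q : ℝ) (X : Matrix (k × (l × Fin 2)) (k × (l × Fin 2)) ℂ) : ℝ :=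
  sInf { s : ℝ | ∃ A B : Matrix (k × (l × Fin 2)) (k × (l × Fin 2)) ℂ,
    A.PosSemidef ∧ B.PosSemidef ∧ X + A = B ∧ s = Psi p q A + Psi p q B }

/-- The block matrix `[[0, Y],[Yᴴ, 0]]`, viewed in `M_k ⊗ (M_l ⊗ M_2)`. -/
noncomputable def clBlock {k l : Type*} (Y : Matrix (k × l) (k × l) ℂ) :
    Matrix (k × (l × Fin 2)) (k × (l × Fin 2)) ℂ :=
  fun x y =>
    if x.2.2 = 0 ∧ y.2.2 = 1 then Y (x.1, x.2.1) (y.1, y.2.1)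
    else if x.2.2 = 1 ∧ y.2.2 = 0 then star (Y (y.1, y.2.1) (x.1, x.2.1))
    else 0

/-- The block-diagonal matrix `diag(P, Q) = [[P, 0],[0, Q]]`, viewed in `M_k ⊗ (M_l ⊗ M_2)`. -/
noncomputable def blockDiag2 {k l : Type*} (P Q : Matrix (k × l) (k × l) ℂ) :
    Matrix (k × (l × Fin 2)) (k × (l × Fin 2)) ℂ :=
  fun x y =>
    if x.2.2 = 0 ∧ y.2.2 = 0 then P (x.1, x.2.1) (y.1, y.2.1)
    else if x.2.2 = 1 ∧ y.2.2 = 1 then Q (x.1, x.2.1) (y.1, y.2.1)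
    else 0

/-- The Carlen–Lieb norm `‖Y‖_{CL} = (1/2) ||| [[0,Y],[Yᴴ,0]] |||_{p,q}`. -/
noncomputable def clNorm {k l : Type*} [Fintype k] [DecidableEq k] [Fintype l] [DecidableEq l]
    (p q : ℝ) (Y : Matrix (k × l) (k × l) ℂ) : ℝ :=
  (1 / 2) * tripleNorm p q (clBlock Y)

end

section Hermitian

variable {k : Type*} [Fintype k] [DecidableEq k]

theorem Matrix.IsHermitian.apply_eq_sum_eigenvalues {M : Matrix k k ℂ} (hM : M.IsHermitian)
    (i j : k) :
    M i j = ∑ l, (hM.eigenvectorUnitary : Matrix k k ℂ) i l * (hM.eigenvalues l : ℂ) *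
      star ((hM.eigenvectorUnitary : Matrix k k ℂ) j l) := by
  conv_lhs => rw [hM.spectral_theorem, Unitary.conjStarAlgAut_apply]
  simp [Matrix.mul_apply, Matrix.diagonal_apply, Matrix.star_apply]

theorem Matrix.IsHermitian.sum_normSq_eigenvectorUnitary {M : Matrix k k ℂ} (hM : M.IsHermitian)
    (i : k) : ∑ l, ‖(hM.eigenvectorUnitary : Matrix k k ℂ) i l‖ ^ 2 = 1 := by
  have h : ((hM.eigenvectorUnitary : Matrix k k ℂ) *
      star (hM.eigenvectorUnitary : Matrix k k ℂ)) i i = 1 := by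
    rw [Unitary.mul_star_self_of_mem hM.eigenvectorUnitary.2, Matrix.one_apply_eq]
  simp only [Matrix.mul_apply, Matrix.star_apply, RCLike.star_def, Complex.mul_conj'] at h
  exact_mod_cast h

theorem Matrix.IsHermitian.re_apply_self_le {M : Matrix k k ℂ} (hM : M.IsHermitian) {c : ℝ}
    (hc : ∀ l, hM.eigenvalues l ≤ c) (i : k) : (M i i).re ≤ c := by
  have h : (M i i).re =
      ∑ l, ‖(hM.eigenvectorUnitary : Matrix k k ℂ) i l‖ ^ 2 * hM.eigenvalues l := by
    rw [hM.apply_eq_sum_eigenvalues i i, Complex.re_sum]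
    refine Finset.sum_congr rfl fun l _ ↦ ?_
    rw [mul_right_comm, RCLike.star_def, Complex.mul_conj']
    norm_cast
  rw [h]
  calc _ ≤ ∑ l, ‖(hM.eigenvectorUnitary : Matrix k k ℂ) i l‖ ^ 2 * c := by
        gcongr with l; exact hc l
    _ = c := by rw [← Finset.sum_mul, hM.sum_normSq_eigenvectorUnitary, one_mul]

theorem Matrix.IsHermitian.eigenvalues_mul_self {M : Matrix k k ℂ} (hM : M.IsHermitian) {t : ℝ}
    (h : M * M = (t : ℂ) • M) (i : k) :
    hM.eigenvalues i * hM.eigenvalues i = t * hM.eigenvalues i := by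
  obtain ⟨D, hD⟩ : ∃ D : Matrix k k ℂ, D = diagonal (RCLike.ofReal ∘ hM.eigenvalues) := ⟨_, rfl⟩
  have key : D * D = (t : ℂ) • D := by
    have e := hM.spectral_theorem
    rw [← hD] at e
    generalize Unitary.conjStarAlgAut ℂ (Matrix k k ℂ) hM.eigenvectorUnitary = φ at e
    rw [e, ← map_mul, ← map_smul] at h
    exact φ.injective h
  have := congrFun (congrFun key i) i
  simp only [hD, Matrix.diagonal_mul_diagonal, Matrix.smul_apply, Matrix.diagonal_apply_eq,
    Function.comp_apply, smul_eq_mul] at this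
  exact Complex.ofReal_injective (by push_cast; exact this)

theorem Matrix.PosSemidef.eigenvalues_rpow {M : Matrix k k ℂ} (hM : M.PosSemidef) {t : ℝ}
    (ht : 0 < t) (h : M * M = (t : ℂ) • M) {s : ℝ} (hs : s ≠ 0) (i : k) :
    hM.isHermitian.eigenvalues i ^ s = t ^ (s - 1) * hM.isHermitian.eigenvalues i := by
  rcases eq_or_ne (hM.isHermitian.eigenvalues i) 0 with h0 | h0
  · simp [h0, hs]
  · rw [mul_right_cancel₀ h0 (hM.isHermitian.eigenvalues_mul_self h i),
      Real.rpow_sub_one ht.ne', div_mul_cancel₀ _ ht.ne']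

theorem mrpow_eq_smul_of_mul_self {M : Matrix k k ℂ} (hM : M.PosSemidef) {t : ℝ}
    (ht : 0 < t) (h : M * M = (t : ℂ) • M) {s : ℝ} (hs : s ≠ 0) :
    mrpow M s = ((t ^ (s - 1) : ℝ) : ℂ) • M := by
  rw [mrpow, dif_pos hM.isHermitian]
  conv_rhs => rw [hM.isHermitian.spectral_theorem, Unitary.conjStarAlgAut_apply]
  rw [← Matrix.smul_mul, ← Matrix.mul_smul, Matrix.star_eq_conjTranspose]
  congr 3
  ext i j
  by_cases hij : i = j
  · subst hij
    simp [hM.eigenvalues_rpow ht h hs i]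
  · simp [hij]

theorem Matrix.IsHermitian.re_trace_eq_sum_eigenvalues {M : Matrix k k ℂ} (hM : M.IsHermitian) :
    (Matrix.trace M).re = ∑ i, hM.eigenvalues i := by
  refine (congrArg Complex.re hM.trace_eq_sum_eigenvalues).trans ?_
  rw [Complex.re_sum]
  exact Finset.sum_congr rfl fun _ _ ↦ Complex.ofReal_re _

theorem re_trace_mrpow {M : Matrix k k ℂ} (hM : M.IsHermitian) (s : ℝ) :
    (Matrix.trace (mrpow M s)).re = ∑ i, hM.eigenvalues i ^ s := by
  rw [mrpow, dif_pos hM, Matrix.trace_mul_cycle, ← Matrix.star_eq_conjTranspose,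
    Unitary.star_mul_self_of_mem hM.eigenvectorUnitary.2, one_mul, Matrix.trace_diagonal,
    Complex.re_sum]
  simp only [Complex.ofReal_re]

theorem Matrix.PosSemidef.rpow_le_re_trace_mrpow {d : k → ℝ}
    (hM : (diagonal fun i ↦ (d i : ℂ)).PosSemidef) (s : ℝ) (i : k) :
    d i ^ s ≤ (Matrix.trace (mrpow (diagonal fun i ↦ (d i : ℂ)) s)).re := by
  rw [re_trace_mrpow hM.isHermitian]
  have hmem : d i ∈ Set.range hM.isHermitian.eigenvalues := by
    rw [← hM.isHermitian.spectrum_real_eq_range_eigenvalues,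
      ← spectrum.algebraMap_mem_iff ℂ]
    simp
  obtain ⟨j, hj⟩ := hmem
  rw [← hj]
  exact Finset.single_le_sum (f := fun i ↦ hM.isHermitian.eigenvalues i ^ s)
    (fun l _ ↦ Real.rpow_nonneg (hM.eigenvalues_nonneg l) _) (Finset.mem_univ j)

end Hermitian

section Schatten

variable {k : Type*} [Fintype k]

theorem conjTranspose_mul_self_apply_self (A : Matrix k k ℂ) (j : k) :
    (Aᴴ * A) j j = ((∑ i, ‖A i j‖ ^ 2 : ℝ) : ℂ) := by
  simp [Matrix.mul_apply, Complex.conj_mul']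

theorem conjTranspose_mul_self_vecMulVec (x y : k → ℂ) :
    (vecMulVec x y)ᴴ * vecMulVec x y =
      ((∑ i, ‖x i‖ ^ 2 : ℝ) : ℂ) • vecMulVec (star y) y := by
  rw [conjTranspose_vecMulVec, vecMulVec_mul_vecMulVec]
  have h : star x ⬝ᵥ x = ((∑ i, ‖x i‖ ^ 2 : ℝ) : ℂ) := by
    simp [dotProduct, Complex.conj_mul']
  rw [h]
  ext i j
  simp [vecMulVec_apply]
  ring

theorem vecMulVec_star_self_mul_self (y : k → ℂ) :
    vecMulVec (star y) y * vecMulVec (star y) y =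
      ((∑ i, ‖y i‖ ^ 2 : ℝ) : ℂ) • vecMulVec (star y) y := by
  rw [← conjTranspose_mul_self_vecMulVec y y, conjTranspose_vecMulVec, vecMulVec_mul_vecMulVec,
    vecMulVec_mul_vecMulVec, dotProduct_comm]

variable [DecidableEq k]

theorem schattenNorm_ofReal {s : ℝ} (hs : 0 < s) (A : Matrix k k ℂ) :
    schattenNorm (ENNReal.ofReal s) A =
      (∑ i, (posSemidef_conjTranspose_mul_self A).isHermitian.eigenvalues i ^ (s / 2)) ^
        (1 / s) := by
  rw [schattenNorm, if_neg ENNReal.ofReal_ne_top, ENNReal.toReal_ofReal hs.le]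

theorem schattenNorm_ofReal_nonneg {s : ℝ} (hs : 0 < s) (A : Matrix k k ℂ) :
    0 ≤ schattenNorm (ENNReal.ofReal s) A := by
  rw [schattenNorm_ofReal hs]
  exact Real.rpow_nonneg (Finset.sum_nonneg fun i _ ↦ Real.rpow_nonneg
    ((posSemidef_conjTranspose_mul_self A).eigenvalues_nonneg i) _) _

theorem schattenNorm_conjTranspose (s : ℝ≥0∞) (A : Matrix k k ℂ) :
    schattenNorm s Aᴴ = schattenNorm s A := by
  have h : (posSemidef_conjTranspose_mul_self Aᴴ).isHermitian.eigenvalues =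
      (posSemidef_conjTranspose_mul_self A).isHermitian.eigenvalues := by
    rw [IsHermitian.eigenvalues_eq_eigenvalues_iff, charpoly_mul_comm, conjTranspose_conjTranspose]
  simp only [schattenNorm, h]

theorem schattenNorm_two_mul_sq {r : ℝ} (hr : 0 < r) (A : Matrix k k ℂ) :
    schattenNorm (ENNReal.ofReal (2 * r)) A ^ 2 =
      (∑ i, (posSemidef_conjTranspose_mul_self A).isHermitian.eigenvalues i ^ r) ^ (1 / r) := by
  rw [schattenNorm_ofReal (by positivity), mul_div_cancel_left₀ _ two_ne_zero,
    ← Real.rpow_natCast, ← Real.rpow_mul]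
  · congr 1
    push_cast
    field_simp
  · exact Finset.sum_nonneg fun i _ ↦ Real.rpow_nonneg
      ((posSemidef_conjTranspose_mul_self A).eigenvalues_nonneg i) _

theorem sum_normSq_col_le_schattenNorm_sq {r : ℝ} (hr : 0 < r) (A : Matrix k k ℂ) (j : k) :
    ∑ i, ‖A i j‖ ^ 2 ≤ schattenNorm (ENNReal.ofReal (2 * r)) A ^ 2 := by
  have hM := posSemidef_conjTranspose_mul_self A
  have h := hM.isHermitian.re_apply_self_le
    (c := schattenNorm (ENNReal.ofReal (2 * r)) A ^ 2) (fun l ↦ ?_) j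
  · rwa [conjTranspose_mul_self_apply_self, Complex.ofReal_re] at h
  · rw [schattenNorm_two_mul_sq hr, one_div,
      Real.le_rpow_inv_iff_of_pos (hM.eigenvalues_nonneg l) (Finset.sum_nonneg fun i _ ↦
        Real.rpow_nonneg (hM.eigenvalues_nonneg i) _) hr]
    exact Finset.single_le_sum (f := fun i ↦ hM.isHermitian.eigenvalues i ^ r)
      (fun i _ ↦ Real.rpow_nonneg (hM.eigenvalues_nonneg i) _) (Finset.mem_univ l)

theorem sum_normSq_le_card_rpow_mul_schattenNorm_sq {r : ℝ} (hr : 1 ≤ r) (A : Matrix k k ℂ) :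
    ∑ j, ∑ i, ‖A i j‖ ^ 2 ≤
      (Fintype.card k : ℝ) ^ (1 - 1 / r) * schattenNorm (ENNReal.ofReal (2 * r)) A ^ 2 := by
  have hr0 : 0 < r := by linarith
  have hM := posSemidef_conjTranspose_mul_self A
  have hnn : 0 ≤ ∑ i, hM.isHermitian.eigenvalues i ^ r :=
    Finset.sum_nonneg fun i _ ↦ Real.rpow_nonneg (hM.eigenvalues_nonneg i) _
  have htr : ∑ j, ∑ i, ‖A i j‖ ^ 2 = ∑ i, hM.isHermitian.eigenvalues i := by
    rw [← hM.isHermitian.re_trace_eq_sum_eigenvalues, Matrix.trace, Complex.re_sum]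
    simp only [Matrix.diag_apply, conjTranspose_mul_self_apply_self, Complex.ofReal_re]
  have hpow := Real.rpow_sum_le_const_mul_sum_rpow_of_nonneg Finset.univ hr
    (fun i _ ↦ hM.eigenvalues_nonneg i)
  rw [htr, schattenNorm_two_mul_sq hr0]
  rw [← Real.le_rpow_inv_iff_of_pos
    (Finset.sum_nonneg fun i _ ↦ hM.eigenvalues_nonneg i) (by positivity) hr0,
    Real.mul_rpow (by positivity) hnn, ← Real.rpow_mul (by positivity), Finset.card_univ] at hpow
  convert hpow using 3
  · field_simp
  · rw [one_div]

theorem schattenNorm_vecMulVec_le {s : ℝ} (hs : 0 < s) (x y : k → ℂ) :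
    schattenNorm (ENNReal.ofReal s) (vecMulVec x y) ≤
      √(∑ i, ‖x i‖ ^ 2) * √(∑ i, ‖y i‖ ^ 2) := by
  have hM := posSemidef_conjTranspose_mul_self (vecMulVec x y)
  set a := ∑ i, ‖x i‖ ^ 2 with ha
  set b := ∑ i, ‖y i‖ ^ 2 with hb
  have ha0 : 0 ≤ a := by positivity
  have hb0 : 0 ≤ b := by positivity
  have hsq : ((vecMulVec x y)ᴴ * vecMulVec x y) * ((vecMulVec x y)ᴴ * vecMulVec x y) =
      ((a * b : ℝ) : ℂ) • ((vecMulVec x y)ᴴ * vecMulVec x y) := by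
    rw [conjTranspose_mul_self_vecMulVec, Matrix.smul_mul, Matrix.mul_smul,
      vecMulVec_star_self_mul_self, ← ha, ← hb]
    simp only [smul_smul]
    congr 1
    push_cast
    ring
  have htr : ∑ i, hM.isHermitian.eigenvalues i = a * b := by
    have hy : star y ⬝ᵥ y = (b : ℂ) := by simp [dotProduct, Complex.conj_mul', hb]
    rw [← hM.isHermitian.re_trace_eq_sum_eigenvalues, conjTranspose_mul_self_vecMulVec, trace_smul,
      trace_vecMulVec, hy, smul_eq_mul, ← Complex.ofReal_mul, Complex.ofReal_re]
  rw [schattenNorm_ofReal hs, ← Real.sqrt_mul ha0]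
  rcases (mul_nonneg ha0 hb0).eq_or_lt with h0 | hpos
  · have hz : ∀ i, hM.isHermitian.eigenvalues i = 0 := fun i ↦
      (Finset.sum_eq_zero_iff_of_nonneg fun i _ ↦ hM.eigenvalues_nonneg i).1
        (htr.trans h0.symm) i (Finset.mem_univ i)
    simp only [hz]
    rw [Real.zero_rpow (by positivity), Finset.sum_const_zero, Real.zero_rpow (by positivity)]
    positivity
  · apply le_of_eq
    simp only [hM.eigenvalues_rpow hpos hsq (s := s / 2) (by positivity)]
    rw [← Finset.mul_sum, htr, Real.rpow_sub_one hpos.ne', div_mul_cancel₀ _ hpos.ne',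
      ← Real.rpow_mul hpos.le, Real.sqrt_eq_rpow]
    congr 1
    field_simp

end Schatten

theorem two_mul_ncR_ofReal {p q : ℝ} (hp : 0 < p) (hpq : p < q) :
    2 * ncR (ENNReal.ofReal p) (ENNReal.ofReal q) = ENNReal.ofReal (2 * (1 / p - 1 / q)⁻¹) := by
  have hq : 0 < q := hp.trans hpq
  have hlt : q⁻¹ < p⁻¹ := inv_strictAnti₀ hp hpq
  rw [ncR, ← ENNReal.ofReal_inv_of_pos hp, ← ENNReal.ofReal_inv_of_pos hq,
    max_eq_left (ENNReal.ofReal_le_ofReal hlt.le), min_eq_right (ENNReal.ofReal_le_ofReal hlt.le),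
    ← ENNReal.ofReal_sub _ (by positivity), ← ENNReal.ofReal_inv_of_pos (sub_pos.2 hlt),
    ENNReal.ofReal_mul (by norm_num), one_div, one_div]
  norm_num

section Schmidt

variable {k : Type*} [DecidableEq k]

/-- The vector `∑ i, √(d i) e i ⊗ e i`. -/
noncomputable def schmidtVec (d : k → ℝ) : k × k → ℂ :=
  fun x ↦ if x.1 = x.2 then (√(d x.1) : ℂ) else 0

/-- The rank-one matrix whose reduced density matrix is `diagonal d`. -/
noncomputable def schmidtState (d : k → ℝ) : Matrix (k × k) (k × k) ℂ :=
  vecMulVec (star (schmidtVec d)) (schmidtVec d)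

theorem star_schmidtVec (d : k → ℝ) : star (schmidtVec d) = schmidtVec d := by
  ext x
  simp only [schmidtVec, Pi.star_apply]
  split_ifs <;> simp

variable [Fintype k]

theorem sum_normSq_schmidtVec {d : k → ℝ} (hd : ∀ i, 0 ≤ d i) :
    ∑ x, ‖schmidtVec d x‖ ^ 2 = ∑ i, d i := by
  rw [Fintype.sum_prod_type]
  refine Finset.sum_congr rfl fun i _ ↦ ?_
  rw [Finset.sum_eq_single i]
  · simp [schmidtVec, Real.sq_sqrt (hd i)]
  · intro j _ hj
    simp [schmidtVec, hj.symm]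
  · simp

theorem posSemidef_schmidtState (d : k → ℝ) : (schmidtState d).PosSemidef :=
  posSemidef_vecMulVec_star_self _

theorem schmidtState_mul_self {d : k → ℝ} (hd : ∀ i, 0 ≤ d i) :
    schmidtState d * schmidtState d = ((∑ i, d i : ℝ) : ℂ) • schmidtState d := by
  rw [schmidtState, vecMulVec_star_self_mul_self, sum_normSq_schmidtVec hd]

theorem ptrace2_schmidtState {d : k → ℝ} (hd : ∀ i, 0 ≤ d i) (c : ℝ) :
    ptrace2 ((c : ℂ) • schmidtState d) = diagonal fun i ↦ ((c * d i : ℝ) : ℂ) := by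
  ext i i'
  simp only [ptrace2, schmidtState, star_schmidtVec, Matrix.smul_apply, vecMulVec_apply, schmidtVec,
    diagonal_apply, smul_eq_mul]
  rw [Finset.sum_eq_single i]
  · by_cases h : i = i'
    · subst h
      simp only [if_true, ← Complex.ofReal_mul, Real.mul_self_sqrt (hd i)]
    · simp [h, Ne.symm h]
  · intro j _ hj
    simp [hj.symm]
  · simp

theorem schattenNorm_kronecker_schmidtState_le {s : ℝ} (hs : 0 < s) {d : k → ℝ}
    (hd : ∀ i, 0 ≤ d i) (A B : Matrix k k ℂ) :
    schattenNorm (ENNReal.ofReal s)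
        ((A ⊗ₖ (1 : Matrix k k ℂ)) * schmidtState d * (B ⊗ₖ (1 : Matrix k k ℂ))) ≤
      √(∑ j, d j * ∑ i, ‖A i j‖ ^ 2) * √(∑ j, d j * ∑ i, ‖Bᴴ i j‖ ^ 2) := by
  rw [schmidtState, star_schmidtVec, mul_vecMulVec, vecMulVec_mul]
  refine (schattenNorm_vecMulVec_le hs _ _).trans_eq ?_
  congr 2
  · rw [Fintype.sum_prod_type_right]
    refine Finset.sum_congr rfl fun j _ ↦ ?_
    rw [Finset.mul_sum]
    refine Finset.sum_congr rfl fun i _ ↦ ?_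
    have h : ((A ⊗ₖ (1 : Matrix k k ℂ)) *ᵥ schmidtVec d) (i, j) = A i j * (√(d j) : ℂ) := by
      simp [mulVec, dotProduct, Fintype.sum_prod_type, schmidtVec, one_apply, kroneckerMap_apply]
    rw [h, norm_mul, mul_pow, Complex.norm_real, Real.norm_eq_abs, sq_abs, Real.sq_sqrt (hd j),
      mul_comm]
  · rw [Fintype.sum_prod_type_right]
    refine Finset.sum_congr rfl fun j _ ↦ ?_
    rw [Finset.mul_sum]
    refine Finset.sum_congr rfl fun i _ ↦ ?_
    have h : (schmidtVec d ᵥ* (B ⊗ₖ (1 : Matrix k k ℂ))) (i, j) = (√(d j) : ℂ) * B j i := by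
      simp [vecMul, dotProduct, Fintype.sum_prod_type, schmidtVec, one_apply, kroneckerMap_apply]
    rw [h, norm_mul, mul_pow, Complex.norm_real, Real.norm_eq_abs, sq_abs, Real.sq_sqrt (hd j),
      conjTranspose_apply, norm_star]

theorem rpow_le_Psi_schmidtState {p q : ℝ} (hp : 0 < p) (hq : 0 < q) {d : k → ℝ}
    (hd : ∀ i, 0 ≤ d i) {i : k} (hi : 1 ≤ d i) :
    (∑ j, d j) ^ ((p - 1) / p) ≤ Psi p q (schmidtState d) := by
  have ht : 0 < ∑ j, d j :=
    (zero_lt_one.trans_le hi).trans_le (Finset.single_le_sum (fun j _ ↦ hd j) (Finset.mem_univ i))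
  rw [Psi, mrpow_eq_smul_of_mul_self (posSemidef_schmidtState d) ht (schmidtState_mul_self hd)
    hp.ne', ptrace2_schmidtState hd]
  have hc : 0 ≤ (∑ j, d j) ^ (p - 1) := Real.rpow_nonneg ht.le _
  have hpos : (diagonal fun j ↦ (((∑ j, d j) ^ (p - 1) * d j : ℝ) : ℂ)).PosSemidef :=
    PosSemidef.diagonal fun j ↦ by
      simpa only [Pi.zero_apply, Complex.zero_le_real] using mul_nonneg hc (hd j)
  calc (∑ j, d j) ^ ((p - 1) / p) = (((∑ j, d j) ^ (p - 1)) ^ (q / p)) ^ (1 / q) := by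
        rw [← Real.rpow_mul ht.le, ← Real.rpow_mul ht.le]
        congr 1
        field_simp
    _ ≤ (((∑ j, d j) ^ (p - 1) * d i) ^ (q / p)) ^ (1 / q) := by
        gcongr
        exact le_mul_of_one_le_right hc hi
    _ ≤ _ := by
        refine Real.rpow_le_rpow (Real.rpow_nonneg (mul_nonneg hc (hd i)) _) ?_ (by positivity)
        exact hpos.rpow_le_re_trace_mrpow (q / p) i

theorem ncNormSup_schmidtState_le {p q c : ℝ} (hp : 0 < p) (hpq : p < q) (hc : 0 ≤ c) {d : k → ℝ}
    (hd : ∀ i, 0 ≤ d i)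
    (h : ∀ A : Matrix k k ℂ, ∑ j, d j * ∑ i, ‖A i j‖ ^ 2 ≤
      c * schattenNorm (ENNReal.ofReal (2 * (1 / p - 1 / q)⁻¹)) A ^ 2) :
    ncNormSup (ENNReal.ofReal p) (ENNReal.ofReal q) (schmidtState d) ≤ c := by
  have hr : 0 < 2 * (1 / p - 1 / q)⁻¹ := by
    have := one_div_lt_one_div_of_lt hp hpq
    have := inv_pos.2 (sub_pos.2 this)
    positivity
  rw [ncNormSup, two_mul_ncR_ofReal hp hpq]
  have hsqrt : ∀ A : Matrix k k ℂ, √(∑ j, d j * ∑ i, ‖A i j‖ ^ 2) ≤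
      √c * schattenNorm (ENNReal.ofReal (2 * (1 / p - 1 / q)⁻¹)) A := fun A ↦ by
    refine (Real.sqrt_le_sqrt (h A)).trans_eq ?_
    rw [Real.sqrt_mul hc, Real.sqrt_sq (schattenNorm_ofReal_nonneg hr A)]
  refine Real.iSup_le (fun A ↦ Real.iSup_le (fun B ↦ ?_) hc) hc
  have hA := schattenNorm_ofReal_nonneg hr A
  have hB := schattenNorm_ofReal_nonneg hr B
  refine div_le_of_le_mul₀ (mul_nonneg hA hB) hc ?_
  refine (schattenNorm_kronecker_schmidtState_le hp hd A B).trans ?_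
  calc _ ≤ (√c * schattenNorm (ENNReal.ofReal (2 * (1 / p - 1 / q)⁻¹)) A) *
        (√c * schattenNorm (ENNReal.ofReal (2 * (1 / p - 1 / q)⁻¹)) B) := by
        gcongr
        · exact hsqrt A
        · simpa only [schattenNorm_conjTranspose] using hsqrt Bᴴ
    _ = _ := by
        rw [mul_mul_mul_comm, Real.mul_self_sqrt hc]

theorem sum_spike_mul_normSq_le {r : ℝ} (hr : 1 ≤ r) (i₀ : k) (A : Matrix k k ℂ) :
    ∑ j, ((if j = i₀ then 1 else 0) + (Fintype.card k : ℝ) ^ (1 / r - 1)) * ∑ i, ‖A i j‖ ^ 2 ≤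
      2 * schattenNorm (ENNReal.ofReal (2 * r)) A ^ 2 := by
  have hcard : (0 : ℝ) < Fintype.card k := by exact_mod_cast Fintype.card_pos_iff.2 ⟨i₀⟩
  simp only [add_mul, ite_mul, one_mul, zero_mul, Finset.sum_add_distrib, ← Finset.mul_sum,
    Finset.sum_ite_eq', Finset.mem_univ, if_true]
  have h₁ := sum_normSq_col_le_schattenNorm_sq (zero_lt_one.trans_le hr) A i₀
  have h₂ := mul_le_mul_of_nonneg_left (sum_normSq_le_card_rpow_mul_schattenNorm_sq hr A)
    (Real.rpow_nonneg hcard.le (1 / r - 1))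
  rw [← mul_assoc, ← Real.rpow_add hcard] at h₂
  rw [show 1 / r - 1 + (1 - 1 / r) = 0 by ring, Real.rpow_zero, one_mul] at h₂
  linarith

end Schmidt

/-- **`Ψ_{p,q}` is not dominated by the NC norm** for `1 < p ≤ 2`, `p < q`: the ratio
`Ψ_{p,q}(Y)/‖Y‖_{NC}` is unbounded over positive semidefinite matrices (of varying dimension). -/
theorem psi_div_ncNorm_unbounded (p q : ℝ) (hp1 : 1 < p) (hp2 : p ≤ 2) (hpq : p < q) :
    ∀ K : ℝ, 0 < K → ∃ (n m : ℕ), 0 < n ∧ 0 < m ∧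
      ∃ Y : Matrix (Fin n × Fin m) (Fin n × Fin m) ℂ, Y ≠ 0 ∧ Y.PosSemidef ∧
        K * ncNormSup (ENNReal.ofReal p) (ENNReal.ofReal q) Y < Psi p q Y := by
  intro K hK
  have hp0 : 0 < p := by linarith
  have hq0 : 0 < q := by linarith
  set r := (1 / p - 1 / q)⁻¹ with hr
  have hlt := one_div_lt_one_div_of_lt hp0 hpq
  have hr1 : 1 ≤ r := by
    refine (one_le_inv₀ (sub_pos.2 hlt)).2 ?_
    have h₁ : 1 / p ≤ 1 := (div_le_one hp0).2 hp1.le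
    have h₂ : 0 < 1 / q := by positivity
    linarith
  have hr0 : 0 < r := by linarith
  have hexp : 0 < 1 / r * ((p - 1) / p) := by
    have := sub_pos.2 hp1
    positivity
  obtain ⟨n, hn, hn0⟩ := (((tendsto_rpow_atTop hexp).comp tendsto_natCast_atTop_atTop).eventually
    (Filter.eventually_gt_atTop (K * 2))).and (Filter.eventually_gt_atTop 0) |>.exists
  rw [Function.comp_apply] at hn
  have hnR : (0 : ℝ) < n := by exact_mod_cast hn0
  set i₀ : Fin n := ⟨0, hn0⟩
  set d : Fin n → ℝ := fun j ↦ (if j = i₀ then 1 else 0) + (n : ℝ) ^ (1 / r - 1) with hd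
  have hε : 0 ≤ (n : ℝ) ^ (1 / r - 1) := by positivity
  have hd0 : ∀ j, 0 ≤ d j := fun j ↦ add_nonneg (by split_ifs <;> norm_num) hε
  have hsum : (n : ℝ) ^ (1 / r) ≤ ∑ j, d j := by
    simp only [hd, Finset.sum_add_distrib, Finset.sum_ite_eq', Finset.mem_univ, if_true,
      Finset.sum_const, Finset.card_univ, Fintype.card_fin, nsmul_eq_mul]
    rw [Real.rpow_sub_one hnR.ne', mul_div_cancel₀ _ hnR.ne']
    linarith
  have hnc : ncNormSup (ENNReal.ofReal p) (ENNReal.ofReal q) (schmidtState d) ≤ 2 :=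
    ncNormSup_schmidtState_le hp0 hpq zero_le_two hd0 fun A ↦ by
      simpa only [Fintype.card_fin] using sum_spike_mul_normSq_le hr1 i₀ A
  have hPsi := rpow_le_Psi_schmidtState hp0 hq0 hd0 (i := i₀)
    (by simpa only [hd, if_true] using le_add_of_nonneg_right hε)
  refine ⟨n, n, hn0, hn0, schmidtState d, fun h0 ↦ ?_, posSemidef_schmidtState d, ?_⟩
  · have h := congrFun (congrFun h0 (i₀, i₀)) (i₀, i₀)
    have hpos : 0 < d i₀ := by simp only [hd, if_true]; linarith
    simp [schmidtState, star_schmidtVec, vecMulVec_apply, schmidtVec,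
      (Real.sqrt_pos.2 hpos).ne'] at h
  · calc K * ncNormSup (ENNReal.ofReal p) (ENNReal.ofReal q) (schmidtState d) ≤ K * 2 := by
          gcongr
      _ < (n : ℝ) ^ (1 / r * ((p - 1) / p)) := hn
      _ = ((n : ℝ) ^ (1 / r)) ^ ((p - 1) / p) := Real.rpow_mul hnR.le _ _
      _ ≤ (∑ j, d j) ^ ((p - 1) / p) := by
          have := sub_pos.2 hp1
          gcongr
      _ ≤ Psi p q (schmidtState d) := hPsi
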